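/- arXiv:2603.22884 — 2 statements merged into one kernel-verified Lean document; each statement's English description precedes it below -/
import Mathlib

section
/- Let T' be a tree of order n(T') ≥ 2 and let T be the tree obtained from T' by attaching a path P_1 to a support vertex of T'. Then γ_t^{oi}(S(T)) = γ_t^{oi}(S(T')) + 1. -/
open SimpleGraph

universe u

/-- A total outer-independent dominating set: every vertex has a neighbor in `D`,
and the complement of `D` is an independent set. -/
def IsTOIDS {V : Type u} (G : SimpleGraph V) (D : Set V) : Prop :=
  (∀ v : V, ∃ u ∈ D, G.Adj v u) ∧ ∀ u ∉ D, ∀ w ∉ D, ¬ G.Adj u w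

/-- The total outer-independent domination number. -/
noncomputable def toidNumber {V : Type u} (G : SimpleGraph V) : ℕ :=
  sInf {n : ℕ | ∃ D : Set V, IsTOIDS G D ∧ D.ncard = n}

/-- The subdivision graph: each edge is replaced by a new vertex adjacent exactly to
its two endpoints. -/
def subdivision {V : Type u} (G : SimpleGraph V) : SimpleGraph (V ⊕ G.edgeSet) :=
  SimpleGraph.fromRel fun x y =>
    ∃ (v : V) (e : G.edgeSet), x = Sum.inl v ∧ y = Sum.inr e ∧ v ∈ (e : Sym2 V)

/-- A leaf: a vertex with exactly one neighbor. -/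
def IsLeafVert {V : Type u} (G : SimpleGraph V) (v : V) : Prop := ∃! u, G.Adj v u

/-- A support vertex: a vertex adjacent to a leaf. -/
def IsSupportVert {V : Type u} (G : SimpleGraph V) (v : V) : Prop :=
  ∃ u, G.Adj v u ∧ IsLeafVert G u

/-- A strong support vertex: a vertex adjacent to at least two leaves. -/
def IsStrongSupportVert {V : Type u} (G : SimpleGraph V) (v : V) : Prop :=
  ∃ u w, u ≠ w ∧ G.Adj v u ∧ G.Adj v w ∧ IsLeafVert G u ∧ IsLeafVert G w

/-- A strong leaf: a leaf adjacent to a strong support vertex. -/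
def IsStrongLeaf {V : Type u} (G : SimpleGraph V) (v : V) : Prop :=
  IsLeafVert G v ∧ ∃ u, G.Adj v u ∧ IsStrongSupportVert G u

/-- A weak leaf: a leaf that is not a strong leaf. -/
def IsWeakLeaf {V : Type u} (G : SimpleGraph V) (v : V) : Prop :=
  IsLeafVert G v ∧ ¬ IsStrongLeaf G v

/-- A semi-support vertex: neither a leaf nor a support vertex, but adjacent to a
support vertex. -/
def IsSemiSupportVert {V : Type u} (G : SimpleGraph V) (v : V) : Prop :=
  ¬ IsLeafVert G v ∧ ¬ IsSupportVert G v ∧ ∃ u, G.Adj v u ∧ IsSupportVert G u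

/-- The number of leaves, with the convention that `P₂` has exactly one leaf. -/
noncomputable def leafCount {V : Type u} (G : SimpleGraph V) : ℕ :=
  if Nat.card V = 2 then 1 else {v | IsLeafVert G v}.ncard

/-- The number of support vertices, with the convention that `P₂` has exactly one
support vertex. -/
noncomputable def supportCount {V : Type u} (G : SimpleGraph V) : ℕ :=
  if Nat.card V = 2 then 1 else {v | IsSupportVert G v}.ncard

/-- The graph obtained from `G` by attaching a path `P_r` to the vertex `v`:
the new vertices form a path `p₀ p₁ ⋯ p_{r-1}` and `v` is joined to the end `p₀`. -/
def attachPath {V : Type u} (G : SimpleGraph V) (v : V) (r : ℕ) :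
    SimpleGraph (V ⊕ Fin r) :=
  SimpleGraph.fromRel fun x y =>
    (∃ a b, x = Sum.inl a ∧ y = Sum.inl b ∧ G.Adj a b) ∨
    (∃ i j : Fin r, x = Sum.inr i ∧ y = Sum.inr j ∧ (j : ℕ) = (i : ℕ) + 1) ∨
    (∃ i : Fin r, x = Sum.inl v ∧ y = Sum.inr i ∧ (i : ℕ) = 0)

/-- The graph obtained from `G` by adding a disjoint copy of the tree `Q_r`
(`r` paths `P₃` joined to a central vertex) and identifying the central vertex
of `Q_r` with the vertex `v` of `G`. -/
def attachQ {V : Type u} (G : SimpleGraph V) (v : V) (r : ℕ) :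
    SimpleGraph (V ⊕ Fin r × Fin 3) :=
  SimpleGraph.fromRel fun x y =>
    (∃ a b, x = Sum.inl a ∧ y = Sum.inl b ∧ G.Adj a b) ∨
    (∃ i : Fin r, x = Sum.inl v ∧ y = Sum.inr (i, 0)) ∨
    (∃ (i : Fin r) (j k : Fin 3),
      x = Sum.inr (i, j) ∧ y = Sum.inr (i, k) ∧ (k : ℕ) = (j : ℕ) + 1)

/-- The family `F`: all trees obtainable from `P₂` by repeatedly
(F1) attaching `P₁` to a support vertex, (F2) attaching `P₂` to a support or
semi-support vertex, (F3) attaching `P₃` to a weak leaf. -/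
inductive InFamilyF : {W : Type u} → SimpleGraph W → Prop
  | base {W : Type u} (G : SimpleGraph W) (e : G ≃g SimpleGraph.pathGraph 2) :
      InFamilyF G
  | op1 {W : Type u} {G' : SimpleGraph W} {v : W} (hv : IsSupportVert G' v)
      (hF : InFamilyF G') {U : Type u} (G : SimpleGraph U)
      (e : G ≃g attachPath G' v 1) : InFamilyF G
  | op2 {W : Type u} {G' : SimpleGraph W} {v : W}
      (hv : IsSupportVert G' v ∨ IsSemiSupportVert G' v)
      (hF : InFamilyF G') {U : Type u} (G : SimpleGraph U)
      (e : G ≃g attachPath G' v 2) : InFamilyF G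
  | op3 {W : Type u} {G' : SimpleGraph W} {v : W} (hv : IsWeakLeaf G' v)
      (hF : InFamilyF G') {U : Type u} (G : SimpleGraph U)
      (e : G ≃g attachPath G' v 3) : InFamilyF G

/-- The family `𝒯`: all trees obtainable from `P₂` by repeatedly
(O1) attaching `P₁` to a support vertex, (O2) attaching `P₃` to a support vertex or a
weak leaf, (O3) adding a copy of `Q_r` (`r ≥ 2`) identifying its central vertex with a
weak leaf. -/
inductive InFamilyT : {W : Type u} → SimpleGraph W → Prop
  | base {W : Type u} (G : SimpleGraph W) (e : G ≃g SimpleGraph.pathGraph 2) :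
      InFamilyT G
  | op1 {W : Type u} {G' : SimpleGraph W} {v : W} (hv : IsSupportVert G' v)
      (hF : InFamilyT G') {U : Type u} (G : SimpleGraph U)
      (e : G ≃g attachPath G' v 1) : InFamilyT G
  | op2 {W : Type u} {G' : SimpleGraph W} {v : W}
      (hv : IsSupportVert G' v ∨ IsWeakLeaf G' v)
      (hF : InFamilyT G') {U : Type u} (G : SimpleGraph U)
      (e : G ≃g attachPath G' v 3) : InFamilyT G
  | op3 {W : Type u} {G' : SimpleGraph W} {v : W} (hv : IsWeakLeaf G' v)
      (hF : InFamilyT G') {r : ℕ} (hr : 2 ≤ r) {U : Type u} (G : SimpleGraph U)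
      (e : G ≃g attachQ G' v r) : InFamilyT G

theorem toidNumber_le {W : Type u} {G : SimpleGraph W} {D : Set W} (hD : IsTOIDS G D) :
    toidNumber G ≤ D.ncard :=
  Nat.sInf_le ⟨D, hD, rfl⟩

theorem exists_isTOIDS_ncard_eq {W : Type u} {G : SimpleGraph W} (h : ∃ D, IsTOIDS G D) :
    ∃ D, IsTOIDS G D ∧ D.ncard = toidNumber G := by
  obtain ⟨D, hD⟩ := h
  exact Nat.sInf_mem (s := {n : ℕ | ∃ D : Set W, IsTOIDS G D ∧ D.ncard = n}) ⟨_, D, hD, rfl⟩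

theorem isTOIDS_univ {W : Type u} {G : SimpleGraph W} (h : ∀ w, ∃ z, G.Adj w z) :
    IsTOIDS G Set.univ :=
  ⟨fun w => (h w).imp fun _ hz => ⟨Set.mem_univ _, hz⟩, fun w hw => (hw (Set.mem_univ w)).elim⟩

/-- If `u e v` is a pendant path ending in the leaf `u`, some minimum total outer-independent
dominating set contains `v`. -/
theorem exists_minimum_isTOIDS_mem {W : Type u} [Finite W] {G : SimpleGraph W} {u e v : W}
    (huv : u ≠ v) (hu : ∀ w, G.Adj u w ↔ w = e) (he : ∀ w, G.Adj e w ↔ w = u ∨ w = v)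
    (h : ∃ D, IsTOIDS G D) :
    ∃ D, IsTOIDS G D ∧ D.ncard = toidNumber G ∧ v ∈ D := by
  obtain ⟨D, hD, hcard⟩ := exists_isTOIDS_ncard_eq h
  by_cases hv : v ∈ D
  · exact ⟨D, hD, hcard, hv⟩
  have heD : e ∈ D := by
    obtain ⟨w, hw, hadj⟩ := hD.1 u
    rwa [← (hu w).1 hadj]
  have huD : u ∈ D := by
    obtain ⟨w, hw, hadj⟩ := hD.1 e
    rcases (he w).1 hadj with rfl | rfl
    · exact hw
    · exact absurd hw hv
  have heu : e ≠ u := ((hu e).2 rfl).ne'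
  refine ⟨insert v (D \ {u}), ⟨fun w => ?_, fun a ha b hb hab => ?_⟩, ?_, Set.mem_insert _ _⟩
  · by_cases hwe : w = e
    · exact ⟨v, Set.mem_insert _ _, by rw [hwe, he]; exact Or.inr rfl⟩
    · obtain ⟨z, hz, hadj⟩ := hD.1 w
      refine ⟨z, Or.inr ⟨hz, ?_⟩, hadj⟩
      rintro rfl
      exact hwe ((hu w).1 hadj.symm)
  · have key : ∀ a b, a ∉ insert v (D \ {u}) → b ∉ insert v (D \ {u}) → G.Adj a b → a ∉ D := by
      intro a b ha hb hab haD
      have hau : a = u := by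
        by_contra hne
        exact ha (Or.inr ⟨haD, hne⟩)
      subst hau
      rw [hu] at hab
      subst hab
      exact hb (Or.inr ⟨heD, heu⟩)
    exact hD.2 a (key a b ha hb hab) b (key b a hb ha hab.symm) hab
  · rw [Set.ncard_insert_of_notMem (fun h' => hv h'.1), Set.ncard_sdiff_singleton_add_one huD, hcard]

/-- Attaching a path `P₂` to a vertex `v` which already carries a pendant path of length two
raises the total outer-independent domination number by one. -/
theorem toidNumber_eq_add_one {A B : Type u} [Finite A] [Finite B] {G : SimpleGraph A}
    {H : SimpleGraph B} (φ : G ↪g H) {u e v : A} {x f : B} (huv : u ≠ v)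
    (hu : ∀ w, G.Adj u w ↔ w = e) (he : ∀ w, G.Adj e w ↔ w = u ∨ w = v)
    (hf : f ∉ Set.range φ) (hB : ∀ b, b = x ∨ b = f ∨ b ∈ Set.range φ)
    (hxadj : ∀ b, H.Adj x b ↔ b = f) (hfadj : ∀ b, H.Adj f b ↔ b = x ∨ b = φ v)
    (hu' : ∀ b, H.Adj (φ u) b ↔ b = φ e)
    (hG : ∃ D, IsTOIDS G D) :
    toidNumber H = toidNumber G + 1 := by
  obtain ⟨D, hD, hcard, hvD⟩ := exists_minimum_isTOIDS_mem huv hu he hG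
  have hExt : IsTOIDS H (insert f (φ '' D)) := by
    have key : ∀ a b, a ∉ insert f (φ '' D) → b ∉ insert f (φ '' D) → H.Adj a b →
        a ∈ Set.range φ := by
      intro a b ha hb hab
      rcases hB a with rfl | rfl | h
      · rw [hxadj] at hab
        exact absurd (Or.inl hab) hb
      · exact absurd (Set.mem_insert _ _) ha
      · exact h
    refine ⟨fun b => ?_, fun a ha b hb hab => ?_⟩
    · rcases hB b with rfl | rfl | ⟨a, rfl⟩
      · exact ⟨f, Set.mem_insert _ _, (hxadj f).2 rfl⟩
      · exact ⟨φ v, Or.inr ⟨v, hvD, rfl⟩, (hfadj _).2 (Or.inr rfl)⟩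
      · obtain ⟨z, hz, hadj⟩ := hD.1 a
        exact ⟨φ z, Or.inr ⟨z, hz, rfl⟩, φ.map_adj_iff.2 hadj⟩
    · obtain ⟨a, rfl⟩ := key a b ha hb hab
      obtain ⟨b, rfl⟩ := key b _ hb ha hab.symm
      exact hD.2 a (fun h => ha (Or.inr ⟨a, h, rfl⟩)) b (fun h => hb (Or.inr ⟨b, h, rfl⟩))
        (φ.map_adj_iff.1 hab)
  apply le_antisymm
  · refine (toidNumber_le hExt).trans ?_
    rw [Set.ncard_insert_of_notMem, Set.ncard_image_of_injective _ φ.injective, hcard]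
    rintro ⟨a, -, rfl⟩
    exact hf ⟨a, rfl⟩
  · obtain ⟨E, hE, hEcard⟩ := exists_isTOIDS_ncard_eq ⟨_, hExt⟩
    have hfE : f ∈ E := by
      obtain ⟨w, hw, hadj⟩ := hE.1 x
      rwa [← (hxadj w).1 hadj]
    have heE : φ e ∈ E := by
      obtain ⟨w, hw, hadj⟩ := hE.1 (φ u)
      rwa [← (hu' w).1 hadj]
    have hRes : IsTOIDS G (φ ⁻¹' E) := by
      refine ⟨fun a => ?_, fun a ha b hb hab => hE.2 _ ha _ hb (φ.map_adj_iff.2 hab)⟩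
      obtain ⟨w, hw, hadj⟩ := hE.1 (φ a)
      rcases hB w with rfl | rfl | ⟨z, rfl⟩
      · exact absurd ⟨a, (hxadj _).1 hadj.symm⟩ hf
      · rcases (hfadj _).1 hadj.symm with h | h
        · obtain ⟨z, -, hz⟩ := hD.1 a
          exact absurd ⟨z, (hxadj _).1 (h ▸ φ.map_adj_iff.2 hz)⟩ hf
        · obtain rfl := φ.injective h
          exact ⟨e, heE, ((he a).2 (Or.inr rfl)).symm⟩
      · exact ⟨z, hw, φ.map_adj_iff.1 hadj⟩
    calc toidNumber G + 1 ≤ (φ ⁻¹' E).ncard + 1 := Nat.add_le_add_right (toidNumber_le hRes) 1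
      _ = (insert f (φ '' (φ ⁻¹' E))).ncard := by
        rw [Set.ncard_insert_of_notMem, Set.ncard_image_of_injective _ φ.injective]
        rintro ⟨a, -, rfl⟩
        exact hf ⟨a, rfl⟩
      _ ≤ E.ncard := Set.ncard_le_ncard
        (Set.insert_subset hfE (Set.image_preimage_subset _ _))
      _ = toidNumber H := hEcard

section Subdivision

variable {W : Type u} (G : SimpleGraph W)

@[simp]
theorem subdivision_adj_inl_inl (a b : W) : ¬ (subdivision G).Adj (Sum.inl a) (Sum.inl b) := by
  simp [subdivision]

@[simp]
theorem subdivision_adj_inr_inr (a b : G.edgeSet) :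
    ¬ (subdivision G).Adj (Sum.inr a) (Sum.inr b) := by
  simp [subdivision]

@[simp]
theorem subdivision_adj_inl_inr (a : W) (b : G.edgeSet) :
    (subdivision G).Adj (Sum.inl a) (Sum.inr b) ↔ a ∈ (b : Sym2 W) := by
  simp [subdivision]

@[simp]
theorem subdivision_adj_inr_inl (a : W) (b : G.edgeSet) :
    (subdivision G).Adj (Sum.inr b) (Sum.inl a) ↔ a ∈ (b : Sym2 W) := by
  simp [subdivision]

variable {G}

/-- A graph embedding induces an embedding of the subdivision graphs. -/
def subdivisionEmbedding {X : Type u} {H : SimpleGraph X} (φ : G ↪g H) :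
    subdivision G ↪g subdivision H where
  toFun := Sum.map φ φ.mapEdgeSet
  inj' := φ.injective.sumMap φ.mapEdgeSet.injective
  map_rel_iff' := by
    rintro (a | a) (b | b) <;> simp

/-- In the subdivision graph, a leaf `a` of `G` is adjacent only to its edge. -/
theorem subdivision_adj_leaf {a b : W} (hab : G.Adj a b) (ha : ∀ c, G.Adj a c → c = b)
    (w : W ⊕ G.edgeSet) :
    (subdivision G).Adj (Sum.inl a) w ↔ w = Sum.inr ⟨s(a, b), hab⟩ := by
  rcases w with w | ⟨w, hw⟩
  · simp
  · rw [subdivision_adj_inl_inr]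
    constructor
    · rintro ⟨c, rfl⟩
      obtain rfl := ha c hw
      rfl
    · intro h
      obtain rfl : w = s(a, b) := congrArg Subtype.val (Sum.inr_injective h)
      exact Sym2.mem_mk_left a b

theorem subdivision_adj_edge {a b : W} (hab : G.Adj a b) (w : W ⊕ G.edgeSet) :
    (subdivision G).Adj (Sum.inr ⟨s(a, b), hab⟩) w ↔ w = Sum.inl a ∨ w = Sum.inl b := by
  rcases w with w | w <;> simp

theorem exists_subdivision_adj (h : ∀ a, ∃ b, G.Adj a b) (w : W ⊕ G.edgeSet) :
    ∃ z, (subdivision G).Adj w z := by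
  rcases w with a | ⟨b, hb⟩
  · obtain ⟨b, hab⟩ := h a
    exact ⟨Sum.inr ⟨s(a, b), hab⟩, by simp⟩
  · induction b with
    | h a c => exact ⟨Sum.inl a, by simp⟩

end Subdivision

section AttachPath

variable {W : Type u} (G : SimpleGraph W) (v : W)

@[simp]
theorem attachPath_adj_inl_inl (r : ℕ) (a b : W) :
    (attachPath G v r).Adj (Sum.inl a) (Sum.inl b) ↔ G.Adj a b := by
  simp only [attachPath, SimpleGraph.fromRel_adj]
  simpa [G.adj_comm b a] using fun h : G.Adj a b => h.ne

theorem attachPath_one_adj_inr (i : Fin 1) (z : W ⊕ Fin 1) :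
    (attachPath G v 1).Adj (Sum.inr i) z ↔ z = Sum.inl v := by
  rcases z with z | z
  · simp [attachPath, Subsingleton.elim i 0]
  · simp [attachPath, Subsingleton.elim z i]

/-- The graph `G` embeds into the graph obtained by attaching a path. -/
def attachPathEmbedding (r : ℕ) : G ↪g attachPath G v r where
  toFun := Sum.inl
  inj' := Sum.inl_injective
  map_rel_iff' := attachPath_adj_inl_inl G v r _ _

end AttachPath

theorem attach_P1_to_support {V : Type u} [Fintype V] (T' : SimpleGraph V)
    (hT' : T'.IsTree) (hn : 2 ≤ Nat.card V) (v : V) (hv : IsSupportVert T' v) :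
    toidNumber (subdivision (attachPath T' v 1)) = toidNumber (subdivision T') + 1 := by
  obtain ⟨u, hvu, hleaf⟩ := hv
  have huniq : ∀ c, T'.Adj u c → c = v := fun c hc => hleaf.unique hc hvu.symm
  have : Nontrivial V := Finite.one_lt_card_iff_nontrivial.1 hn
  have hp : (attachPath T' v 1).Adj (Sum.inr 0) (Sum.inl v) :=
    (attachPath_one_adj_inr T' v 0 _).2 rfl
  have hu' : (attachPath T' v 1).Adj (Sum.inl u) (Sum.inl v) :=
    (attachPath_adj_inl_inl T' v 1 u v).2 hvu.symm
  refine toidNumber_eq_add_one (subdivisionEmbedding (attachPathEmbedding T' v 1))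
    (u := Sum.inl u) (e := Sum.inr ⟨s(u, v), hvu.symm⟩) (v := Sum.inl v)
    (x := Sum.inl (Sum.inr 0)) (f := Sum.inr ⟨s(Sum.inr 0, Sum.inl v), hp⟩)
    (fun h => hvu.ne' (Sum.inl_injective h)) (subdivision_adj_leaf hvu.symm huniq)
    (subdivision_adj_edge hvu.symm) ?_ ?_
    (subdivision_adj_leaf hp fun c => (attachPath_one_adj_inr T' v 0 c).1)
    (subdivision_adj_edge hp) (subdivision_adj_leaf hu' ?_)
    ⟨_, isTOIDS_univ (exists_subdivision_adj fun a => ?_)⟩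
  · rintro ⟨a | ⟨a, ha⟩, h⟩
    · exact Sum.inl_ne_inr h
    · have h' : Sym2.map Sum.inl a = s(Sum.inr (0 : Fin 1), Sum.inl v) :=
        congrArg Subtype.val (Sum.inr_injective h)
      have hm : (Sum.inr (0 : Fin 1) : V ⊕ Fin 1) ∈ Sym2.map Sum.inl a :=
        h' ▸ Sym2.mem_mk_left _ _
      obtain ⟨c, -, hc⟩ := Sym2.mem_map.1 hm
      exact Sum.inl_ne_inr hc
  · rintro ((a | i) | ⟨b, hb⟩)
    · exact Or.inr (Or.inr ⟨Sum.inl a, rfl⟩)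
    · exact Or.inl (by rw [Subsingleton.elim i 0])
    · induction b with
      | h c d =>
        rcases c with c | i
        · rcases d with d | j
          · exact Or.inr (Or.inr
              ⟨Sum.inr ⟨s(c, d), (attachPath_adj_inl_inl T' v 1 c d).1 hb⟩, rfl⟩)
          · obtain rfl : c = v := Sum.inl_injective
              ((attachPath_one_adj_inr T' v j _).1 (SimpleGraph.Adj.symm hb))
            obtain rfl := Subsingleton.elim 0 j
            exact Or.inr (Or.inl (congrArg Sum.inr (Subtype.ext Sym2.eq_swap)))
        · obtain rfl : d = Sum.inl v := (attachPath_one_adj_inr T' v i _).1 hb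
          obtain rfl := Subsingleton.elim 0 i
          exact Or.inr (Or.inl rfl)
  · rintro (c | i) hc
    · rw [huniq c ((attachPath_adj_inl_inl T' v 1 u c).1 hc)]
    · have := Sum.inl_injective ((attachPath_one_adj_inr T' v i _).1 hc.symm)
      exact absurd this hvu.ne'
  · exact hT'.1.preconnected.exists_adj_of_nontrivial a
end

section
/- Let T' be a tree of order n(T') ≥ 2, let r ≥ 2 be an integer, and let T be the tree obtained from T' by adding a disjoint copy of the tree Q_r and identifying its central vertex with a weak leaf of T'. Then γ_t^{oi}(S(T)) = γ_t^{oi}(S(T')) + 4r. -/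
open SimpleGraph

universe u

/-- A pair of a vertex set `A` and an edge set `B` of `G` that forms a total outer-independent
dominating set of the subdivision graph of `G`. -/
structure IsSubdivTOIDS {V : Type u} (G : SimpleGraph V) (A : Set V) (B : Set (Sym2 V)) : Prop where
  subset : B ⊆ G.edgeSet
  vert : ∀ v, ∃ e ∈ B, v ∈ e
  edge : ∀ e ∈ G.edgeSet, ∃ v ∈ A, v ∈ e
  cover : ∀ e ∈ G.edgeSet, ∀ v ∈ e, v ∈ A ∨ e ∈ B

lemma subdivision_adj_inl_inr_s6 {V : Type u} {G : SimpleGraph V} {v : V} {e : G.edgeSet} :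
    (subdivision G).Adj (.inl v) (.inr e) ↔ v ∈ (e : Sym2 V) := by
  simp [subdivision]

lemma subdivision_not_adj_inl_inl {V : Type u} {G : SimpleGraph V} {v w : V} :
    ¬ (subdivision G).Adj (.inl v) (.inl w) := by
  simp [subdivision]

lemma subdivision_not_adj_inr_inr {V : Type u} {G : SimpleGraph V} {e f : G.edgeSet} :
    ¬ (subdivision G).Adj (.inr e) (.inr f) := by
  simp [subdivision]

lemma ncard_sum {α β : Type*} [Finite α] [Finite β] (D : Set (α ⊕ β)) :
    D.ncard = (Sum.inl ⁻¹' D).ncard + (Sum.inr ⁻¹' D).ncard := by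
  conv_lhs => rw [← Set.image_preimage_inl_union_image_preimage_inr D]
  rw [Set.ncard_union_eq, Set.ncard_image_of_injective _ Sum.inl_injective,
    Set.ncard_image_of_injective _ Sum.inr_injective]
  rw [Set.disjoint_left]
  rintro _ ⟨a, _, rfl⟩ ⟨b, _, h⟩
  cases h

lemma exists_isTOIDS_subdivision_iff {V : Type u} [Finite V] (G : SimpleGraph V) (n : ℕ) :
    (∃ D, IsTOIDS (subdivision G) D ∧ D.ncard = n) ↔
      ∃ A B, IsSubdivTOIDS G A B ∧ A.ncard + B.ncard = n := by
  constructor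
  · rintro ⟨D, ⟨hd, hc⟩, rfl⟩
    refine ⟨Sum.inl ⁻¹' D, Subtype.val '' (Sum.inr ⁻¹' D), ⟨?_, fun v => ?_, fun e he => ?_,
      fun e he v hv => ?_⟩, ?_⟩
    · rintro _ ⟨e, _, rfl⟩
      exact e.2
    · obtain ⟨w | e, hu, h⟩ := hd (.inl v)
      · exact absurd h subdivision_not_adj_inl_inl
      · exact ⟨e, ⟨e, hu, rfl⟩, subdivision_adj_inl_inr_s6.1 h⟩
    · obtain ⟨w | f, hu, h⟩ := hd (.inr ⟨e, he⟩)
      · exact ⟨w, hu, subdivision_adj_inl_inr_s6.1 h.symm⟩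
      · exact absurd h subdivision_not_adj_inr_inr
    · by_contra! h
      exact hc (.inl v) h.1 (.inr ⟨e, he⟩) (fun h' => h.2 ⟨_, h', rfl⟩)
        (subdivision_adj_inl_inr_s6.2 hv)
    · rw [Set.ncard_image_of_injective _ Subtype.val_injective, ← ncard_sum]
  · rintro ⟨A, B, h, rfl⟩
    refine ⟨Sum.inl '' A ∪ Sum.inr '' (Subtype.val ⁻¹' B), ⟨?_, ?_⟩, ?_⟩
    · rintro (v | e)
      · obtain ⟨e, he, hv⟩ := h.vert v
        exact ⟨.inr ⟨e, h.subset he⟩, by simpa using he, subdivision_adj_inl_inr_s6.2 hv⟩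
      · obtain ⟨v, hv, hve⟩ := h.edge e e.2
        exact ⟨.inl v, by simpa using hv, (subdivision_adj_inl_inr_s6.2 hve).symm⟩
    · have key : ∀ (v : V) (e : G.edgeSet), v ∉ A → (e : Sym2 V) ∉ B →
          ¬ (subdivision G).Adj (.inl v) (.inr e) := fun v e hv he hadj =>
        (h.cover e e.2 v (subdivision_adj_inl_inr_s6.1 hadj)).elim hv he
      rintro (v | e) hu (w | f) hw
      · exact subdivision_not_adj_inl_inl
      · exact key v f (by simpa using hu) (by simpa using hw)
      · exact fun hadj => key w e (by simpa using hw) (by simpa using hu) hadj.symm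
      · exact subdivision_not_adj_inr_inr
    · have hB : (Subtype.val '' (Subtype.val ⁻¹' B : Set G.edgeSet)) = B := by
        rw [Subtype.image_preimage_coe]
        exact Set.inter_eq_right.2 h.subset
      rw [ncard_sum]
      congr 1
      · congr 1
        ext; simp
      · rw [← hB, Set.ncard_image_of_injective _ Subtype.val_injective]
        congr 1
        ext; simp

lemma toidNumber_subdivision {V : Type u} [Finite V] (G : SimpleGraph V) :
    toidNumber (subdivision G) =
      sInf {n | ∃ A B, IsSubdivTOIDS G A B ∧ A.ncard + B.ncard = n} := by
  simp only [toidNumber, exists_isTOIDS_subdivision_iff]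

lemma toidNumber_subdivision_le {V : Type u} [Finite V] {G : SimpleGraph V} {A : Set V}
    {B : Set (Sym2 V)} (h : IsSubdivTOIDS G A B) :
    toidNumber (subdivision G) ≤ A.ncard + B.ncard := by
  rw [toidNumber_subdivision]
  exact Nat.sInf_le ⟨A, B, h, rfl⟩

lemma exists_isSubdivTOIDS_eq {V : Type u} [Finite V] {G : SimpleGraph V}
    (hG : ∃ A B, IsSubdivTOIDS G A B) :
    ∃ A B, IsSubdivTOIDS G A B ∧ A.ncard + B.ncard = toidNumber (subdivision G) := by
  obtain ⟨A, B, h⟩ := hG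
  rw [toidNumber_subdivision]
  exact Nat.sInf_mem (s := {n | ∃ A B, IsSubdivTOIDS G A B ∧ A.ncard + B.ncard = n})
    ⟨_, A, B, h, rfl⟩

lemma isSubdivTOIDS_univ {V : Type u} {G : SimpleGraph V} (hG : ∀ v, ∃ w, G.Adj v w) :
    IsSubdivTOIDS G Set.univ G.edgeSet where
  subset := subset_rfl
  vert v := by
    obtain ⟨w, hw⟩ := hG v
    exact ⟨s(v, w), hw, Sym2.mem_mk_left v w⟩
  edge e _ := by
    induction e with
    | _ a b => exact ⟨a, trivial, Sym2.mem_mk_left a b⟩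
  cover _ _ _ _ := Or.inl trivial

/-- The neighbour towards the centre of a vertex of a path of `attachQ`. -/
def attachQPred {V : Type u} (v : V) {r : ℕ} (i : Fin r) : Fin 3 → V ⊕ Fin r × Fin 3
  | 0 => .inl v
  | 1 => .inr (i, 0)
  | 2 => .inr (i, 1)

/-- The edges of `attachQ`: an old edge, or the edge joining a new vertex to its neighbour
towards the centre. -/
def attachQEdge {V : Type u} (v : V) (r : ℕ) :
    Sym2 V ⊕ Fin r × Fin 3 → Sym2 (V ⊕ Fin r × Fin 3)
  | .inl e => e.map .inl
  | .inr (i, j) => s(attachQPred v i j, .inr (i, j))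

lemma attachQEdge_injective {V : Type u} (v : V) (r : ℕ) :
    Function.Injective (attachQEdge v r) := by
  rintro (e | ⟨i, j⟩) (f | ⟨k, l⟩) h
  · exact congrArg _ (Sym2.map.injective Sum.inl_injective h)
  · have hm : Sum.inr (k, l) ∈ attachQEdge v r (.inl e) := h ▸ Sym2.mem_mk_right _ _
    simp [attachQEdge] at hm
  · have hm : Sum.inr (i, j) ∈ attachQEdge v r (.inl f) := h ▸ Sym2.mem_mk_right _ _
    simp [attachQEdge] at hm
  · fin_cases j <;> fin_cases l <;> simp_all [attachQEdge, attachQPred]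

lemma mem_edgeSet_attachQ_iff {V : Type u} {G : SimpleGraph V} {v : V} {r : ℕ}
    {e : Sym2 (V ⊕ Fin r × Fin 3)} :
    e ∈ (attachQ G v r).edgeSet ↔
      (∃ f ∈ G.edgeSet, attachQEdge v r (.inl f) = e) ∨
        ∃ x, attachQEdge v r (.inr x) = e := by
  constructor
  · induction e with
    | _ x y =>
    have key : ∀ x y : V ⊕ Fin r × Fin 3,
        ((∃ a b, x = Sum.inl a ∧ y = Sum.inl b ∧ G.Adj a b) ∨
        (∃ i : Fin r, x = Sum.inl v ∧ y = Sum.inr (i, 0)) ∨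
        (∃ (i : Fin r) (j k : Fin 3),
          x = Sum.inr (i, j) ∧ y = Sum.inr (i, k) ∧ (k : ℕ) = (j : ℕ) + 1)) →
        (∃ f ∈ G.edgeSet, attachQEdge v r (.inl f) = s(x, y)) ∨
          ∃ z, attachQEdge v r (.inr z) = s(x, y) := by
      rintro _ _ (⟨a, b, rfl, rfl, h⟩ | ⟨i, rfl, rfl⟩ | ⟨i, j, k, rfl, rfl, h⟩)
      · exact .inl ⟨s(a, b), h, rfl⟩
      · exact .inr ⟨(i, 0), rfl⟩
      · refine .inr ⟨(i, k), ?_⟩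
        fin_cases j <;> fin_cases k <;> simp_all [attachQEdge, attachQPred]
    rintro ⟨_, h | h⟩
    · exact key _ _ h
    · rw [Sym2.eq_swap]
      exact key _ _ h
  · rintro (⟨f, hf, rfl⟩ | ⟨⟨i, j⟩, rfl⟩)
    · induction f with
      | _ a b =>
      exact ⟨by simpa using G.ne_of_adj hf, .inl (.inl ⟨a, b, rfl, rfl, hf⟩)⟩
    · fin_cases j <;>
        simp [attachQEdge, attachQPred, attachQ]

lemma ncard_eq_add_sum_indicator {α : Type*} [Finite α] {r : ℕ} (S : Set (α ⊕ Fin r × Fin 3)) :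
    S.ncard = (Sum.inl ⁻¹' S).ncard + ∑ i, ∑ j, (Sum.inr ⁻¹' S).indicator 1 (i, j) := by
  classical
  rw [ncard_sum, ← Fintype.sum_prod_type' fun i j => (Sum.inr ⁻¹' S).indicator 1 (i, j)]
  simp [Set.indicator_apply, Set.ncard_eq_toFinset_card' (Sum.inr ⁻¹' S),
    Fintype.card_subtype]

lemma IsSubdivTOIDS.attachQ {V : Type u} {G : SimpleGraph V} {A : Set V} {B : Set (Sym2 V)}
    (h : IsSubdivTOIDS G A B) (v : V) (r : ℕ) :
    IsSubdivTOIDS (attachQ G v r) (Sum.inl '' A ∪ Sum.inr '' {x | x.2 ≠ 2})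
      (attachQEdge v r '' (Sum.inl '' B ∪ Sum.inr '' {x | x.2 ≠ 1})) where
  subset := by
    rintro _ ⟨_, ⟨e, he, rfl⟩ | ⟨x, _, rfl⟩, rfl⟩
    · exact mem_edgeSet_attachQ_iff.2 (.inl ⟨e, h.subset he, rfl⟩)
    · exact mem_edgeSet_attachQ_iff.2 (.inr ⟨x, rfl⟩)
  vert := by
    rintro (w | ⟨i, j⟩)
    · obtain ⟨e, he, hw⟩ := h.vert w
      exact ⟨_, ⟨_, .inl ⟨e, he, rfl⟩, rfl⟩, Sym2.mem_map.2 ⟨w, hw, rfl⟩⟩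
    · fin_cases j
      · exact ⟨_, ⟨_, .inr ⟨(i, 0), by simp, rfl⟩, rfl⟩, by simp [attachQEdge]⟩
      · exact ⟨_, ⟨_, .inr ⟨(i, 2), by simp, rfl⟩, rfl⟩, by simp [attachQEdge, attachQPred]⟩
      · exact ⟨_, ⟨_, .inr ⟨(i, 2), by simp, rfl⟩, rfl⟩, by simp [attachQEdge]⟩
  edge e he := by
    obtain ⟨f, hf, rfl⟩ | ⟨⟨i, j⟩, rfl⟩ := mem_edgeSet_attachQ_iff.1 he
    · obtain ⟨w, hw, hwf⟩ := h.edge f hf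
      exact ⟨.inl w, .inl ⟨w, hw, rfl⟩, Sym2.mem_map.2 ⟨w, hwf, rfl⟩⟩
    · fin_cases j
      · exact ⟨.inr (i, 0), by simp, by simp [attachQEdge]⟩
      · exact ⟨.inr (i, 0), by simp, by simp [attachQEdge, attachQPred]⟩
      · exact ⟨.inr (i, 1), by simp, by simp [attachQEdge, attachQPred]⟩
  cover e he x hx := by
    obtain ⟨f, hf, rfl⟩ | ⟨⟨i, j⟩, rfl⟩ := mem_edgeSet_attachQ_iff.1 he
    · obtain ⟨w, hw, rfl⟩ := Sym2.mem_map.1 hx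
      exact (h.cover f hf w hw).imp (fun h => .inl ⟨w, h, rfl⟩)
        fun h => ⟨_, .inl ⟨f, h, rfl⟩, rfl⟩
    · by_cases hj : j = 1
      · subst hj
        left
        simp only [attachQEdge, attachQPred, Sym2.mem_iff] at hx
        rcases hx with rfl | rfl <;> simp
      · exact .inr ⟨_, .inr ⟨(i, j), hj, rfl⟩, rfl⟩

/-- The restriction of a dominating pair of `attachQ G v r` to `G`, given that the only edge of
`G` at `v` is the edge to `u`. -/
lemma IsSubdivTOIDS.restrict {V : Type u} [Finite V] {G : SimpleGraph V} {u v : V} {r : ℕ}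
    {A : Set (V ⊕ Fin r × Fin 3)} {B : Set (Sym2 (V ⊕ Fin r × Fin 3))}
    (h : IsSubdivTOIDS (_root_.attachQ G v r) A B) (huv : G.Adj v u)
    (hu : ∀ w, G.Adj v w → w = u) :
    ∃ A' B', IsSubdivTOIDS G A' B' ∧ A'.ncard + B'.ncard ≤
      (Sum.inl ⁻¹' A).ncard + ((attachQEdge v r ∘ Sum.inl) ⁻¹' B).ncard := by
  set A' : Set V := Sum.inl ⁻¹' A
  set B' : Set (Sym2 V) := (attachQEdge v r ∘ Sum.inl) ⁻¹' B
  have hsub : B' ⊆ G.edgeSet := fun e he => by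
    obtain ⟨f, hf, hfe⟩ | ⟨x, hx⟩ := mem_edgeSet_attachQ_iff.1 (h.subset he)
    · exact Sum.inl_injective (attachQEdge_injective v r hfe) ▸ hf
    · cases attachQEdge_injective v r hx
  have hmem {e : Sym2 V} (he : e ∈ G.edgeSet) :
      attachQEdge v r (.inl e) ∈ (_root_.attachQ G v r).edgeSet :=
    mem_edgeSet_attachQ_iff.2 (.inl ⟨e, he, rfl⟩)
  have hvert (w : V) (hw : w ≠ v) : ∃ e ∈ B', w ∈ e := by
    obtain ⟨e, he, hwe⟩ := h.vert (.inl w)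
    obtain ⟨f, -, rfl⟩ | ⟨⟨i, j⟩, rfl⟩ := mem_edgeSet_attachQ_iff.1 (h.subset he)
    · exact ⟨f, he, by simpa [attachQEdge] using hwe⟩
    · fin_cases j <;> simp_all [attachQEdge, attachQPred]
  have hedge (e) (he : e ∈ G.edgeSet) : ∃ w ∈ A', w ∈ e := by
    obtain ⟨x, hx, hxe⟩ := h.edge _ (hmem he)
    obtain ⟨w, hw, rfl⟩ := Sym2.mem_map.1 hxe
    exact ⟨w, hx, hw⟩
  have hcover (e) (he : e ∈ G.edgeSet) (w) (hw : w ∈ e) : w ∈ A' ∨ e ∈ B' :=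
    h.cover _ (hmem he) (.inl w) (Sym2.mem_map.2 ⟨w, hw, rfl⟩)
  by_cases hB : s(v, u) ∈ B'
  · refine ⟨A', B', ⟨hsub, fun w => ?_, hedge, hcover⟩, le_rfl⟩
    by_cases hw : w = v
    · exact ⟨_, hB, by simp [hw]⟩
    · exact hvert w hw
  · have hvA : v ∈ A' := (hcover s(v, u) huv v (by simp)).resolve_right hB
    have huA : u ∈ A' := (hcover s(v, u) huv u (by simp)).resolve_right hB
    have hunique (e) (he : e ∈ G.edgeSet) (hv : v ∈ e) : e = s(v, u) := by
      obtain ⟨w, rfl⟩ := Sym2.mem_iff_exists.1 hv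
      rw [hu w he]
    refine ⟨A' \ {v}, insert s(v, u) B', ⟨?_, fun w => ?_, fun e he => ?_, fun e he w hw => ?_⟩,
      ?_⟩
    · exact Set.insert_subset huv hsub
    · by_cases hw : w = v
      · exact ⟨_, .inl rfl, by simp [hw]⟩
      · obtain ⟨e, he, hwe⟩ := hvert w hw
        exact ⟨e, .inr he, hwe⟩
    · by_cases hv : v ∈ e
      · exact ⟨u, ⟨huA, huv.ne'⟩, by simp [hunique e he hv]⟩
      · obtain ⟨w, hw, hwe⟩ := hedge e he
        exact ⟨w, ⟨hw, fun h => hv (h ▸ hwe)⟩, hwe⟩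
    · by_cases hv : v ∈ e
      · exact .inr (.inl (hunique e he hv))
      · exact (hcover e he w hw).imp (fun h => ⟨h, fun h' => hv (h' ▸ hw)⟩) .inr
    · have h1 := Set.ncard_sdiff_singleton_add_one hvA
      have h2 := Set.ncard_insert_le s(v, u) B'
      omega

/-- Each path of `attachQ` carries at least four elements of a dominating pair. -/
lemma IsSubdivTOIDS.four_le {V : Type u} {G : SimpleGraph V} {v : V} {r : ℕ}
    {A : Set (V ⊕ Fin r × Fin 3)} {B : Set (Sym2 (V ⊕ Fin r × Fin 3))}
    (h : IsSubdivTOIDS (_root_.attachQ G v r) A B) (i : Fin r) :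
    4 ≤ ∑ j, (Sum.inr ⁻¹' A).indicator 1 (i, j) +
      ∑ j, (Sum.inr ⁻¹' (attachQEdge v r ⁻¹' B)).indicator 1 (i, j) := by
  classical
  have hmem (j : Fin 3) : attachQEdge v r (.inr (i, j)) ∈ (_root_.attachQ G v r).edgeSet :=
    mem_edgeSet_attachQ_iff.2 (.inr ⟨_, rfl⟩)
  have hvert (j : Fin 3) : ∃ k, attachQEdge v r (.inr (i, k)) ∈ B ∧
      (k = j ∨ (k : ℕ) = j + 1) := by
    obtain ⟨e, he, hje⟩ := h.vert (.inr (i, j))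
    obtain ⟨f, -, rfl⟩ | ⟨⟨i', k⟩, rfl⟩ := mem_edgeSet_attachQ_iff.1 (h.subset he)
    · simp [attachQEdge] at hje
    · have : i' = i ∧ (k = j ∨ (k : ℕ) = j + 1) := by
        fin_cases k <;> simp [attachQEdge, attachQPred] at hje <;> simp <;> grind
      exact ⟨k, this.1 ▸ he, this.2⟩
  have hp0 := hvert 0
  have hp2 := hvert 2
  have hc : .inr (i, 1) ∈ A ∨ .inr (i, 2) ∈ A := by
    obtain ⟨x, hx, hxe⟩ := h.edge _ (hmem 2)
    obtain rfl | rfl := Sym2.mem_iff.1 hxe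
    exacts [.inl hx, .inr hx]
  have ha0 := h.cover _ (hmem 0) (.inr (i, 0)) (Sym2.mem_mk_right _ _)
  have hb0 := h.cover _ (hmem 1) (.inr (i, 0)) (Sym2.mem_mk_left _ _)
  simp only [Fin.exists_fin_succ, Fin.exists_fin_zero] at hp0 hp2
  simp [attachQEdge, attachQPred] at hp0 hp2 ha0 hb0
  simp only [Fin.sum_univ_three, Set.indicator_apply, Set.mem_preimage, attachQEdge,
    attachQPred, Pi.one_apply]
  split_ifs <;> simp_all

theorem attach_Qr_to_weak_leaf {V : Type u} [Fintype V] (T' : SimpleGraph V)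
    (hT' : T'.IsTree) (hn : 2 ≤ Nat.card V) (r : ℕ) (hr : 2 ≤ r) (v : V)
    (hv : IsWeakLeaf T' v) :
    toidNumber (subdivision (attachQ T' v r)) = toidNumber (subdivision T') + 4 * r := by
  obtain ⟨u, huv, hu⟩ := hv.1
  have : Nontrivial V := Finite.one_lt_card_iff_nontrivial.1 hn
  obtain ⟨A, B, h, hAB⟩ := exists_isSubdivTOIDS_eq
    ⟨_, _, isSubdivTOIDS_univ fun w => hT'.1.preconnected.exists_adj_of_nontrivial w⟩
  have hT := h.attachQ v r
  apply le_antisymm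
  · refine (toidNumber_subdivision_le hT).trans ?_
    rw [Set.ncard_image_of_injective _ (attachQEdge_injective v r), ← hAB,
      ncard_eq_add_sum_indicator, ncard_eq_add_sum_indicator (_ ∪ _)]
    simp [Fin.sum_univ_three, Set.preimage_image_eq, Sum.inl_injective]
    omega
  · obtain ⟨A, B, h, hAB⟩ := exists_isSubdivTOIDS_eq ⟨_, _, hT⟩
    obtain ⟨A', B', h', hle⟩ := h.restrict huv hu
    have hB : (attachQEdge v r ⁻¹' B).ncard ≤ B.ncard := by
      rw [← Set.ncard_image_of_injective _ (attachQEdge_injective v r)]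
      exact Set.ncard_le_ncard (Set.image_preimage_subset _ _)
    have hsum := Finset.sum_le_sum fun i (_ : i ∈ Finset.univ) => h.four_le i
    rw [Finset.sum_add_distrib] at hsum
    simp only [Finset.sum_const, Finset.card_univ, Fintype.card_fin, smul_eq_mul] at hsum
    have hle' := toidNumber_subdivision_le h'
    rw [ncard_eq_add_sum_indicator] at hB
    rw [ncard_eq_add_sum_indicator A] at hAB
    rw [Set.preimage_comp] at hle
    omega
end
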